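/- arXiv:2402.18832 — 2 statements merged into one kernel-verified Lean document; each statement's English description precedes it below -/
import Mathlib

section
/- For every integer n ≥ 3, the paired domination number of the Cartesian product C_5 □ C_n satisfies γ_p(C_5 □ C_n) = h(n), where h(n) = ⌈4n/3⌉ + 1 if n ≡ 2 (mod 3) and h(n) = ⌈4n/3⌉ otherwise. -/
/-- `D` is a dominating set of `G`: every vertex outside `D` has a neighbor in `D`. -/
def IsDominatingSet {V : Type*} (G : SimpleGraph V) (D : Set V) : Prop :=
  ∀ v ∉ D, ∃ u ∈ D, G.Adj u v

/-- `S` is a paired dominating set of `G`: a dominating set such that the subgraph of `G`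
induced on `S` contains a perfect matching. -/
def IsPairedDominatingSet {V : Type*} (G : SimpleGraph V) (S : Set V) : Prop :=
  IsDominatingSet G S ∧ ∃ M : (G.induce S).Subgraph, M.IsPerfectMatching

/-- The paired domination number of `G`: minimum cardinality of a paired dominating set. -/
noncomputable def pairedDominationNumber {V : Type*} [Fintype V] (G : SimpleGraph V) : ℕ :=
  sInf {m | ∃ S : Set V, IsPairedDominatingSet G S ∧ S.ncard = m}

open Finset in
/-- A finite set carrying a fixed-point-free involution has even cardinality. -/
lemma Finset.even_card_of_involution {α : Type*} (s : Finset α) (p : α → α)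
    (hmem : ∀ a ∈ s, p a ∈ s) (hne : ∀ a ∈ s, p a ≠ a) (hinv : ∀ a ∈ s, p (p a) = a) :
    Even #s := by
  rw [← ZMod.natCast_eq_zero_iff_even, ← nsmul_one, ← Finset.sum_const]
  exact Finset.sum_involution (fun a _ => p a) (fun _ _ => by decide)
    (fun a ha _ => hne a ha) hmem hinv

/-- A pairing of the set `S` in `G`: an involution of `S` moving every vertex to a neighbor. -/
structure IsPairing {V : Type*} (G : SimpleGraph V) (S : Set V) (p : V → V) : Prop where
  mem : ∀ v ∈ S, p v ∈ S
  adj : ∀ v ∈ S, G.Adj v (p v)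
  invol : ∀ v ∈ S, p (p v) = v

lemma isPairedDominatingSet_iff_exists_isPairing {V : Type*} (G : SimpleGraph V) (S : Set V) :
    IsPairedDominatingSet G S ↔ IsDominatingSet G S ∧ ∃ p, IsPairing G S p := by
  classical
  refine and_congr_right fun _ => ⟨?_, ?_⟩
  · rintro ⟨M, hM, hS⟩
    choose q hq hu using fun v : S => hM (hS v)
    refine ⟨fun v => if h : v ∈ S then q ⟨v, h⟩ else v, ?_, ?_, ?_⟩
    · intro v hv
      simp [hv]
    · intro v hv
      simpa [hv] using M.adj_sub (hq ⟨v, hv⟩)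
    · intro v hv
      have := hu (q ⟨v, hv⟩) ⟨v, hv⟩ (hq ⟨v, hv⟩).symm
      simp [hv, ← this]
  · rintro ⟨p, hp⟩
    refine ⟨{ verts := Set.univ
              Adj := fun u v => p u = v
              adj_sub := ?_
              edge_vert := fun _ => Set.mem_univ _
              symm := ⟨?_⟩ }, ?_, fun _ => Set.mem_univ _⟩
    · rintro ⟨u, hu⟩ ⟨v, hv⟩ h
      have := hp.adj u hu
      simp only at h
      rwa [h] at this
    · rintro ⟨u, hu⟩ ⟨v, hv⟩ h
      have := hp.invol u hu
      simp only at h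
      rwa [h] at this
    · rintro ⟨v, hv⟩ -
      exact ⟨⟨p v, hp.mem v hv⟩, rfl, fun w hw => Subtype.ext (Eq.symm hw)⟩

open Classical in
/-- The rows in which the set `S` meets column `j`. -/
noncomputable def columnOf {α β : Type*} [Fintype α] (S : Set (α × β)) (j : β) : Finset α :=
  {i | (i, j) ∈ S}

lemma mem_columnOf {α β : Type*} [Fintype α] {S : Set (α × β)} {i : α} {j : β} :
    i ∈ columnOf S j ↔ (i, j) ∈ S := by
  simp [columnOf]

open Finset in
lemma ncard_eq_sum_card_columnOf {α β : Type*} [Fintype α] [Fintype β] (S : Set (α × β)) :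
    S.ncard = ∑ j, #(columnOf S j) := by
  classical
  rw [Set.ncard_eq_toFinset_card', Finset.card_eq_sum_card_fiberwise (f := Prod.snd) (t := univ)
    (fun _ _ => by simp)]
  refine Finset.sum_congr rfl fun j _ => ?_
  refine Finset.card_bij' (fun x _ => x.1) (fun i _ => (i, j)) ?_ ?_ ?_ ?_
  · rintro ⟨a, b⟩ h
    obtain ⟨hab, rfl⟩ : (a, b) ∈ S ∧ b = j := by simpa using h
    exact mem_columnOf.2 hab
  · intro a h
    simpa [mem_columnOf] using h
  · rintro ⟨a, b⟩ h
    simp_all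
  · simp

/-- The maximum size of the open neighborhood of a set of `c` vertices in the 5-cycle. -/
def maxNbrCount (c : Fin 6) : ℕ := ![0, 2, 4, 5, 5, 5] c

open Finset in
lemma card_nbr_le_maxNbrCount (A : Finset (Fin 5)) (c : Fin 6) (hc : #A = c) :
    #{i | i - 1 ∈ A ∨ i + 1 ∈ A} ≤ maxNbrCount c := by
  revert A c
  decide

/-- A potential on the sizes of two consecutive columns, used to bound column sizes on average. -/
def columnPotential (a b : Fin 6) : ℤ :=
  ![![-8, -5, -2, -1, 0, 0], ![-6, -4, -2, 0, 0, 0], ![-6, -3, 0, 0, 0, 0],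
    ![-4, -2, 0, 0, 0, 0], ![-4, -1, 0, 0, 0, 0], ![-4, -1, 0, 0, 0, 0]] a b

lemma columnPotential_step (a b c : Fin 6) (h : 5 ≤ a.val + c.val + maxNbrCount b)
    (hpar : a.val = 0 → c.val = 0 → Even b.val) :
    columnPotential b c ≤ columnPotential a b + (3 * (c.val : ℤ) - 4) := by
  revert a b c
  decide

lemma cycleGraph_five_adj_iff (a b : Fin 5) :
    (SimpleGraph.cycleGraph 5).Adj a b ↔ a = b - 1 ∨ a = b + 1 := by
  revert a b
  decide

open Finset in
/-- If all columns satisfy the local conditions, then the average column size is at least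
`4 / 3`. -/
lemma four_mul_le_three_mul_sum (m : ℕ) (c : Fin (m + 3) → Fin 6)
    (hdom : ∀ j, 5 ≤ (c j).val + (c (j + 1 + 1)).val + maxNbrCount (c (j + 1)))
    (hpar : ∀ j, (c j).val = 0 → (c (j + 1 + 1)).val = 0 → Even (c (j + 1)).val) :
    4 * (m + 3) ≤ 3 * ∑ j, (c j).val := by
  have h := Finset.sum_le_sum fun j (_ : j ∈ univ) =>
    columnPotential_step _ _ _ (hdom j) (hpar j)
  have e₁ := Equiv.sum_comp (Equiv.addRight (1 : Fin (m + 3)))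
    fun j => columnPotential (c j) (c (j + 1))
  have e₂ := Equiv.sum_comp (Equiv.addRight (1 + 1 : Fin (m + 3))) fun j => ((c j).val : ℤ)
  simp only [Equiv.coe_addRight, ← add_assoc] at e₁ e₂
  rw [Finset.sum_add_distrib, e₁, Finset.sum_sub_distrib, ← Finset.mul_sum, e₂] at h
  simp only [sum_const, card_univ, Fintype.card_fin, nsmul_eq_mul] at h
  push_cast at h
  zify
  linarith

open Finset in
lemma four_mul_le_three_mul_ncard (m : ℕ) (S : Set (Fin 5 × Fin (m + 3)))
    (hS : IsPairedDominatingSet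
      ((SimpleGraph.cycleGraph 5).boxProd (SimpleGraph.cycleGraph (m + 3))) S) :
    4 * (m + 3) ≤ 3 * S.ncard ∧ Even S.ncard := by
  classical
  obtain ⟨hD, p, hp⟩ := (isPairedDominatingSet_iff_exists_isPairing _ _).1 hS
  have htot : ∀ v, ∃ u ∈ S,
      ((SimpleGraph.cycleGraph 5).boxProd (SimpleGraph.cycleGraph (m + 3))).Adj u v := by
    intro v
    by_cases hv : v ∈ S
    · exact ⟨p v, hp.mem v hv, (hp.adj v hv).symm⟩
    · exact hD v hv
  constructor
  · have hlt : ∀ j, #(columnOf S j) < 6 := fun j =>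
      Nat.lt_succ_of_le ((Finset.card_le_univ _).trans (by simp))
    rw [ncard_eq_sum_card_columnOf]
    refine four_mul_le_three_mul_sum m (fun j => ⟨#(columnOf S j), hlt j⟩) ?_ ?_
    · intro j
      have hcover : (univ : Finset (Fin 5)) ⊆ columnOf S j ∪ columnOf S (j + 1 + 1) ∪
          ({i | i - 1 ∈ columnOf S (j + 1) ∨ i + 1 ∈ columnOf S (j + 1)} : Finset _) := by
        intro i _
        obtain ⟨⟨a, b⟩, hu, hadj⟩ := htot (i, j + 1)
        rw [SimpleGraph.boxProd_adj, cycleGraph_five_adj_iff, SimpleGraph.cycleGraph_adj] at hadj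
        simp only at hadj
        simp only [mem_union, mem_filter, mem_univ, true_and, mem_columnOf]
        rcases hadj with ⟨rfl | rfl, rfl⟩ | ⟨h | h, rfl⟩
        · exact .inr (.inl hu)
        · exact .inr (.inr hu)
        · rw [sub_eq_iff_eq_add'.1 h] at hu
          exact .inl (.inr hu)
        · rw [← add_right_cancel (sub_eq_iff_eq_add'.1 h)] at hu
          exact .inl (.inl hu)
      have h₁ := Finset.card_le_card hcover
      have h₂ := Finset.card_union_le (columnOf S j ∪ columnOf S (j + 1 + 1))
          ({i | i - 1 ∈ columnOf S (j + 1) ∨ i + 1 ∈ columnOf S (j + 1)} : Finset _)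
      have h₃ := Finset.card_union_le (columnOf S j) (columnOf S (j + 1 + 1))
      have h₄ := card_nbr_le_maxNbrCount (columnOf S (j + 1)) ⟨_, hlt (j + 1)⟩ rfl
      simp only [card_univ, Fintype.card_fin] at h₁ ⊢
      omega
    · intro j h₀ h₂
      simp only [card_eq_zero] at h₀ h₂ ⊢
      have key : ∀ i ∈ columnOf S (j + 1), (p (i, j + 1)).2 = j + 1 := by
        intro i hi
        rw [mem_columnOf] at hi
        have hadj := hp.adj _ hi
        have hmem := hp.mem _ hi
        generalize p (i, j + 1) = w at hadj hmem ⊢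
        obtain ⟨a, b⟩ := w
        simp only [SimpleGraph.boxProd_adj, SimpleGraph.cycleGraph_adj] at hadj
        rcases hadj with ⟨-, rfl⟩ | ⟨h | h, rfl⟩
        · rfl
        · rw [← add_right_cancel (sub_eq_iff_eq_add'.1 h), ← mem_columnOf, h₀] at hmem
          simp at hmem
        · rw [sub_eq_iff_eq_add'.1 h, ← mem_columnOf, h₂] at hmem
          simp at hmem
      have key' : ∀ i ∈ columnOf S (j + 1), ((p (i, j + 1)).1, j + 1) = p (i, j + 1) :=
        fun i hi => Prod.ext rfl (key i hi).symm
      refine Finset.even_card_of_involution _ (fun i => (p (i, j + 1)).1) ?_ ?_ ?_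
      · intro i hi
        rw [mem_columnOf, key' i hi]
        exact hp.mem _ (mem_columnOf.1 hi)
      · intro i hi h
        have h' := key' i hi
        rw [h] at h'
        have := hp.adj _ (mem_columnOf.1 hi)
        rw [← h'] at this
        exact this.ne rfl
      · intro i hi
        simp only [key' i hi, hp.invol _ (mem_columnOf.1 hi)]
  · rw [Set.ncard_eq_toFinset_card']
    refine Finset.even_card_of_involution _ p ?_ ?_ ?_
    · simpa using fun a b h => hp.mem (a, b) h
    · intro v hv
      exact (hp.adj v (by simpa using hv)).ne'
    · intro v hv
      exact hp.invol v (by simpa using hv)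

/-- A paired dominating set of `C₅ □ Cₙ` with three-periodic columns `{2, 3}`, `{0}`, `{0}`,
where the last column is enlarged to `{0, 1}` if `n ≡ 2 (mod 3)`. -/
def periodicSet (n : ℕ) : Set (Fin 5 × Fin n) :=
  {v | (v.2.val % 3 = 0 ∧ (v.1 = 2 ∨ v.1 = 3)) ∨ (v.2.val % 3 ≠ 0 ∧ v.1 = 0) ∨
    (v.2.val % 3 = 1 ∧ v.2.val + 1 = n ∧ v.1 = 1)}

lemma mk_mem_periodicSet {n : ℕ} {i : Fin 5} {j : Fin n} : (i, j) ∈ periodicSet n ↔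
    (j.val % 3 = 0 ∧ (i = 2 ∨ i = 3)) ∨ (j.val % 3 ≠ 0 ∧ i = 0) ∨
      (j.val % 3 = 1 ∧ j.val + 1 = n ∧ i = 1) := Iff.rfl

/-- The partner of a vertex of `periodicSet n`. -/
def periodicPartner (n : ℕ) (v : Fin 5 × Fin n) : Fin 5 × Fin n :=
  if v.2.val % 3 = 0 then (5 - v.1, v.2)
  else if v.2.val % 3 = 2 then (v.1, ⟨v.2.val - 1, by omega⟩)
  else if h : v.2.val + 1 < n then (v.1, ⟨v.2.val + 1, h⟩)
  else (1 - v.1, v.2)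

lemma cycleGraph_adj_of_val_succ {n : ℕ} {u v : Fin n} (h : u.val + 1 = v.val) :
    (SimpleGraph.cycleGraph n).Adj u v := by
  rw [SimpleGraph.cycleGraph_adj']
  right
  rw [Fin.sub_val_of_le (by rw [Fin.le_def]; omega)]
  omega

lemma cycleGraph_adj_last_zero {n : ℕ} (hn : 3 ≤ n) {u v : Fin n} (hu : u.val + 1 = n)
    (hv : v.val = 0) : (SimpleGraph.cycleGraph n).Adj u v := by
  rw [SimpleGraph.cycleGraph_adj']
  right
  rw [Fin.sub_def]
  simp only
  rw [show n - u.val + v.val = 1 by omega, Nat.mod_eq_of_lt (by omega)]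

lemma isPairing_periodicPartner (n : ℕ) :
    IsPairing ((SimpleGraph.cycleGraph 5).boxProd (SimpleGraph.cycleGraph n)) (periodicSet n)
      (periodicPartner n) := by
  suffices H : ∀ v ∈ periodicSet n, periodicPartner n v ∈ periodicSet n ∧
      ((SimpleGraph.cycleGraph 5).boxProd (SimpleGraph.cycleGraph n)).Adj v
        (periodicPartner n v) ∧ periodicPartner n (periodicPartner n v) = v from
    ⟨fun v hv => (H v hv).1, fun v hv => (H v hv).2.1, fun v hv => (H v hv).2.2⟩
  rintro ⟨i, j, hj⟩ hv
  simp only [mk_mem_periodicSet] at hv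
  obtain h | h | h : j % 3 = 0 ∨ j % 3 = 1 ∨ j % 3 = 2 := by omega
  · obtain rfl | rfl : i = 2 ∨ i = 3 := by simpa [h] using hv
    all_goals
      simp [periodicPartner, h, mk_mem_periodicSet, SimpleGraph.boxProd_adj,
        cycleGraph_five_adj_iff]
      decide
  · by_cases hl : j + 1 < n
    · obtain rfl : i = 0 := by simpa [h, hl.ne] using hv
      have h' : (j + 1) % 3 = 2 := by omega
      simp [periodicPartner, h, h', hl, mk_mem_periodicSet, SimpleGraph.boxProd_adj,
        cycleGraph_adj_of_val_succ]
    · obtain rfl | rfl : i = 0 ∨ i = 1 := by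
        rcases hv with hv | hv | hv <;> simp_all
      all_goals
        have : j + 1 = n := by omega
        simp [periodicPartner, h, this, mk_mem_periodicSet, SimpleGraph.boxProd_adj,
          cycleGraph_five_adj_iff]
  · obtain rfl : i = 0 := by simpa [h] using hv
    have h' : (j - 1) % 3 = 1 := by omega
    have hs : j - 1 + 1 = j := by omega
    simp [periodicPartner, h, h', hs, hj, mk_mem_periodicSet, SimpleGraph.boxProd_adj,
      (cycleGraph_adj_of_val_succ (u := ⟨j - 1, by omega⟩) (v := ⟨j, hj⟩) hs).symm]

lemma isDominatingSet_periodicSet (n : ℕ) (hn : 3 ≤ n) :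
    IsDominatingSet ((SimpleGraph.cycleGraph 5).boxProd (SimpleGraph.cycleGraph n))
      (periodicSet n) := by
  have vert : ∀ (i i' : Fin 5) (j : Fin n), (i', j) ∈ periodicSet n → (i' = i - 1 ∨ i' = i + 1) →
      ∃ u ∈ periodicSet n,
        ((SimpleGraph.cycleGraph 5).boxProd (SimpleGraph.cycleGraph n)).Adj u (i, j) :=
    fun i i' j h h' => ⟨(i', j), h, .inl ⟨(cycleGraph_five_adj_iff _ _).2 h', rfl⟩⟩
  have hor : ∀ (i : Fin 5) (j j' : Fin n), (i, j') ∈ periodicSet n →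
      (SimpleGraph.cycleGraph n).Adj j' j → ∃ u ∈ periodicSet n,
        ((SimpleGraph.cycleGraph 5).boxProd (SimpleGraph.cycleGraph n)).Adj u (i, j) :=
    fun i j j' h h' => ⟨(i, j'), h, .inr ⟨h', rfl⟩⟩
  rintro ⟨i, j, hj⟩ hv
  rw [mk_mem_periodicSet] at hv
  simp only at hv
  obtain h | h | h : j % 3 = 0 ∨ j % 3 = 1 ∨ j % 3 = 2 := by omega
  · obtain rfl | rfl | rfl : i = 0 ∨ i = 1 ∨ i = 4 := by
      have : ¬ (i = 2 ∨ i = 3) := by simpa [h] using hv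
      clear hv
      revert i
      decide
    · by_cases hl : j + 1 < n
      · refine hor _ _ ⟨j + 1, hl⟩ ?_ (cycleGraph_adj_of_val_succ rfl).symm
        exact mk_mem_periodicSet.2 (.inr (.inl ⟨by simp only; omega, rfl⟩))
      · refine hor _ _ ⟨j - 1, by omega⟩ ?_ (cycleGraph_adj_of_val_succ (by simp only; omega))
        exact mk_mem_periodicSet.2 (.inr (.inl ⟨by simp only; omega, rfl⟩))
    · exact vert _ 2 _ (.inl ⟨h, .inl rfl⟩) (by decide)
    · exact vert _ 3 _ (.inl ⟨h, .inr rfl⟩) (by decide)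
  all_goals
    obtain rfl | h₁ | h₂ : i = 0 ∨ (0 = i - 1 ∨ 0 = i + 1) ∨ i = 2 ∨ i = 3 := by
      clear hv
      revert i
      decide
    · simp [h] at hv
    · exact vert _ 0 _ (.inr (.inl ⟨by simp only; omega, rfl⟩)) h₁
  · refine hor _ _ ⟨j - 1, by omega⟩ ?_ (cycleGraph_adj_of_val_succ (by simp only; omega))
    exact .inl ⟨by simp only; omega, h₂⟩
  · by_cases hl : j + 1 < n
    · refine hor _ _ ⟨j + 1, hl⟩ ?_ (cycleGraph_adj_of_val_succ rfl).symm
      exact .inl ⟨by simp only; omega, h₂⟩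
    · refine hor _ _ ⟨0, by omega⟩ ?_ (cycleGraph_adj_last_zero hn (by simp only; omega) rfl).symm
      exact .inl ⟨rfl, h₂⟩

open Finset in
lemma card_columnOf_periodicSet (n : ℕ) (j : Fin n) : #(columnOf (periodicSet n) j) =
    (if j.val % 3 = 0 then 2 else 1) + (if j.val % 3 = 1 ∧ j.val + 1 = n then 1 else 0) := by
  classical
  simp only [columnOf, mk_mem_periodicSet]
  by_cases h₀ : j.val % 3 = 0
  · simp [h₀]
    decide
  by_cases h₁ : j.val % 3 = 1 ∧ j.val + 1 = n
  · simp [h₁]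
    decide
  · have : ∀ i : Fin 5, ¬ (j.val % 3 = 1 ∧ j.val + 1 = n ∧ i = 1) := fun i h => h₁ ⟨h.1, h.2.1⟩
    simp [h₀, h₁, this]
    decide

open Finset in
lemma ncard_periodicSet (n : ℕ) (hn : 3 ≤ n) : (periodicSet n).ncard =
    (4 * n + 2) / 3 + (if n % 3 = 2 then 1 else 0) := by
  have hsum : ∀ m : ℕ, ∑ j ∈ range m, (if j % 3 = 0 then 2 else 1) = m + (m + 2) / 3 := by
    intro m
    induction m with
    | zero => rfl
    | succ m ih =>
      rw [Finset.sum_range_succ, ih]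
      split_ifs <;> omega
  have hlast : ∑ j ∈ range n, (if j % 3 = 1 ∧ j + 1 = n then 1 else 0) =
      if n % 3 = 2 then 1 else 0 := by
    rw [Finset.sum_eq_single (n - 1)]
    · split_ifs <;> omega
    · intro j _ hj
      rw [if_neg (by omega)]
    · simp only [mem_range]
      omega
  rw [ncard_eq_sum_card_columnOf]
  simp only [card_columnOf_periodicSet]
  rw [Fin.sum_univ_eq_sum_range (fun j => (if j % 3 = 0 then 2 else 1) +
    (if j % 3 = 1 ∧ j + 1 = n then 1 else 0)) n, Finset.sum_add_distrib, hsum, hlast]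
  split_ifs <;> omega

lemma ceil_four_mul_div_three (n : ℕ) : ⌈(4 * n : ℚ) / 3⌉₊ = (4 * n + 2) / 3 := by
  have h : (4 * n : ℚ) / 3 = ((4 * n : ℕ) : ℚ) / (3 : ℕ) := by push_cast; ring
  refine le_antisymm ?_ ?_
  · rw [Nat.ceil_le, div_le_iff₀ (by norm_num)]
    have : 4 * n ≤ (4 * n + 2) / 3 * 3 := by omega
    exact_mod_cast this
  · have := Nat.le_ceil ((4 * n : ℚ) / 3)
    rw [div_le_iff₀ (by norm_num)] at this
    have : 4 * n ≤ ⌈(4 * n : ℚ) / 3⌉₊ * 3 := by exact_mod_cast this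
    omega

/-- For every `n ≥ 3`, the paired domination number of `C₅ □ Cₙ` is
`⌈4n/3⌉ + 1` if `n ≡ 2 (mod 3)` and `⌈4n/3⌉` otherwise. -/
theorem pairedDominationNumber_C5_boxProd_Cn (n : ℕ) (hn : 3 ≤ n) :
    pairedDominationNumber ((SimpleGraph.cycleGraph 5).boxProd (SimpleGraph.cycleGraph n)) =
      ⌈(4 * n : ℚ) / 3⌉₊ + (if n % 3 = 2 then 1 else 0) := by
  rw [ceil_four_mul_div_three]
  have hmem : (4 * n + 2) / 3 + (if n % 3 = 2 then 1 else 0) ∈ {m | ∃ S : Set (Fin 5 × Fin n),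
      IsPairedDominatingSet
        ((SimpleGraph.cycleGraph 5).boxProd (SimpleGraph.cycleGraph n)) S ∧ S.ncard = m} :=
    ⟨periodicSet n, (isPairedDominatingSet_iff_exists_isPairing _ _).2
      ⟨isDominatingSet_periodicSet n hn, _, isPairing_periodicPartner n⟩,
      ncard_periodicSet n hn⟩
  refine le_antisymm (Nat.sInf_le hmem) (le_csInf ⟨_, hmem⟩ ?_)
  rintro _ ⟨S, hS, rfl⟩
  obtain ⟨m, rfl⟩ := Nat.exists_eq_add_of_le' hn
  obtain ⟨h₁, k, hk⟩ := four_mul_le_three_mul_ncard m S hS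
  split_ifs <;> omega
end

section
/- For every integer n ≥ 3, the upper total domination number of the Cartesian product C_4 □ C_n satisfies Γ_t(C_4 □ C_n) = 2n. -/
/-- `S` is a total dominating set of `G`: every vertex of `G` is adjacent to a vertex
of `S`. -/
def IsTotalDominatingSet {V : Type*} (G : SimpleGraph V) (S : Set V) : Prop :=
  ∀ v : V, ∃ u ∈ S, G.Adj u v

/-- `S` is a minimal total dominating set of `G`: a total dominating set no proper subset
of which is a total dominating set. -/
def IsMinimalTotalDominatingSet {V : Type*} (G : SimpleGraph V) (S : Set V) : Prop :=
  IsTotalDominatingSet G S ∧ ∀ T : Set V, T ⊂ S → ¬ IsTotalDominatingSet G T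

/-- The upper total domination number of `G`: maximum cardinality of a minimal total
dominating set. -/
noncomputable def upperTotalDominationNumber {V : Type*} [Fintype V] (G : SimpleGraph V) : ℕ :=
  sSup {m | ∃ S : Set V, IsMinimalTotalDominatingSet G S ∧ S.ncard = m}

/-- In a minimal total dominating set every element has a private neighbour. -/
theorem IsMinimalTotalDominatingSet.exists_private_neighbor {V : Type*} {G : SimpleGraph V}
    {S : Set V} (h : IsMinimalTotalDominatingSet G S) {v : V} (hv : v ∈ S) :
    ∃ w, G.Adj v w ∧ ∀ u ∈ S, G.Adj u w → u = v := by
  have hT := h.2 (S \ {v}) ⟨Set.sdiff_subset, fun hs => (hs hv).2 rfl⟩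
  unfold IsTotalDominatingSet at hT
  push Not at hT
  obtain ⟨w, hw⟩ := hT
  have key : ∀ u ∈ S, G.Adj u w → u = v := fun u hu hadj => by
    by_contra hne
    exact hw u ⟨hu, hne⟩ hadj
  obtain ⟨u, hu, hadj⟩ := h.1 w
  exact ⟨w, key u hu hadj ▸ hadj, key⟩

/-- A total dominating set all of whose elements have private neighbours is minimal. -/
theorem IsTotalDominatingSet.isMinimal_of_private_neighbor {V : Type*} {G : SimpleGraph V}
    {S : Set V} (h : IsTotalDominatingSet G S)
    (hp : ∀ v ∈ S, ∃ w, ∀ u ∈ S, G.Adj u w → u = v) : IsMinimalTotalDominatingSet G S := by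
  refine ⟨h, fun T hT hdom => hT.2 fun v hv => ?_⟩
  obtain ⟨w, hw⟩ := hp v hv
  obtain ⟨u, hu, hadj⟩ := hdom w
  exact hw u (hT.1 hu) hadj ▸ hu

/-- The parity of a row of the four-cycle. -/
def rowParity (i : Fin 4) : Fin 2 := Fin.ofNat 2 i.val

theorem rowParity_eq_iff : ∀ i k : Fin 4, rowParity i = rowParity k ↔ k = i ∨ k = i + 2 := by
  decide

theorem cycleGraph_four_adj_iff : ∀ i k : Fin 4,
    (SimpleGraph.cycleGraph 4).Adj i k ↔ rowParity k = rowParity i + 1 := by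
  decide

/-- Two consecutive copies of `H` form a minimal total dominating set of `C₄ □ H`. -/
theorem isMinimalTotalDominatingSet_two_rows {W : Type*} (H : SimpleGraph W) :
    IsMinimalTotalDominatingSet ((SimpleGraph.cycleGraph 4).boxProd H)
      {v | v.1 < 2} := by
  have hdom : ∀ i : Fin 4, ∃ k < 2, (SimpleGraph.cycleGraph 4).Adj k i := by decide
  have hpriv : ∀ i : Fin 4, i < 2 → ∃ k, ¬ k < 2 ∧
      ∀ l < 2, (SimpleGraph.cycleGraph 4).Adj l k → l = i := by decide
  refine IsTotalDominatingSet.isMinimal_of_private_neighbor ?_ ?_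
  · rintro ⟨i, j⟩
    obtain ⟨k, hk, hadj⟩ := hdom i
    exact ⟨(k, j), hk, SimpleGraph.boxProd_adj.2 (Or.inl ⟨hadj, rfl⟩)⟩
  · rintro ⟨i, j⟩ hi
    obtain ⟨k, hk, hu⟩ := hpriv i hi
    refine ⟨(k, j), ?_⟩
    rintro ⟨l, j'⟩ hl hadj
    rcases SimpleGraph.boxProd_adj.1 hadj with ⟨h, rfl⟩ | ⟨_, rfl⟩
    · exact Prod.ext (hu l hl h) rfl
    · exact absurd hl hk

/-- A minimal total dominating set of `C₄ □ H` contains at most half of the vertices. -/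
theorem IsMinimalTotalDominatingSet.ncard_le_of_boxProd {W : Type*} [Fintype W]
    {H : SimpleGraph W} {S : Set (Fin 4 × W)}
    (h : IsMinimalTotalDominatingSet ((SimpleGraph.cycleGraph 4).boxProd H) S) :
    S.ncard ≤ 2 * Fintype.card W := by
  classical
  have hex : ∀ v : Fin 4 × W, ∃ w, v ∈ S →
      ((SimpleGraph.cycleGraph 4).boxProd H).Adj v w ∧
      ∀ u ∈ S, ((SimpleGraph.cycleGraph 4).boxProd H).Adj u w → u = v := fun v => by
    by_cases hv : v ∈ S
    · obtain ⟨w, hw⟩ := h.exists_private_neighbor hv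
      exact ⟨w, fun _ => hw⟩
    · exact ⟨v, fun hv' => absurd hv' hv⟩
  choose p hp using hex
  have hne : ∀ i : Fin 4, i + 2 ≠ i := by decide
  have hlt : ∀ i : Fin 4, i < 2 → ¬ i + 2 < 2 := by decide
  have hlt' : ∀ i : Fin 4, ¬ i < 2 → i + 2 < 2 := by decide
  have htwo : ∀ i : Fin 4, i + 2 + 2 = i := by decide
  have hcol : ∀ i j, (i, j) ∈ S → (i + 2, j) ∈ S →
      (p (i, j)).1 = i ∧ H.Adj j (p (i, j)).2 := fun i j h₁ h₂ => by
    obtain ⟨hadj, huniq⟩ := hp _ h₁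
    rcases SimpleGraph.boxProd_adj.1 hadj with ⟨ha, hj⟩ | ⟨ha, hi⟩
    · have := huniq _ h₂ (SimpleGraph.boxProd_adj.2 (Or.inl ⟨?_, hj⟩))
      · exact absurd (congrArg Prod.fst this) (hne i)
      · rw [cycleGraph_four_adj_iff] at ha ⊢
        rw [ha, (rowParity_eq_iff i (i + 2)).2 (Or.inr rfl)]
    · exact ⟨hi.symm, ha⟩
  have hempty : ∀ i j k, (i, j) ∈ S → (i + 2, j) ∈ S →
      rowParity k = rowParity i + 1 → (k, (p (i, j)).2) ∉ S := fun i j k h₁ h₂ hk hmem => by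
    obtain ⟨hi, hH⟩ := hcol i j h₁ h₂
    have := (hp _ h₁).2 _ hmem (SimpleGraph.boxProd_adj.2 (Or.inl ⟨?_, rfl⟩))
    · exact hH.ne (congrArg Prod.snd this).symm
    · rw [hi, SimpleGraph.adj_comm, cycleGraph_four_adj_iff, hk]
  let g : Fin 4 × W → Fin 2 × W := fun v =>
    if v.1 < 2 ∧ (v.1 + 2, v.2) ∈ S then (rowParity v.1 + 1, (p v).2) else (rowParity v.1, v.2)
  have hg : Set.InjOn g S := by
    rintro ⟨i, j⟩ h₁ ⟨k, l⟩ h₂ heq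
    simp only [g] at heq
    split_ifs at heq with c₁ c₂ c₂
    · obtain ⟨hr, hc⟩ := Prod.ext_iff.1 heq
      have hik : k = i := by
        rcases (rowParity_eq_iff i k).1 (add_right_cancel hr) with e | e
        · exact e
        · exact absurd (e ▸ c₂.1) (hlt i c₁.1)
      subst hik
      have e₁ := hcol k j h₁ c₁.2
      have e₂ := hcol k l h₂ c₂.2
      have hpp : p (k, j) = p (k, l) := Prod.ext (e₁.1.trans e₂.1.symm) hc
      exact (hp _ h₂).2 _ h₁ (hpp ▸ (hp _ h₁).1)
    · obtain ⟨hr, rfl⟩ := Prod.ext_iff.1 heq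
      exact absurd h₂ (hempty i j k h₁ c₁.2 hr.symm)
    · obtain ⟨hr, rfl⟩ := Prod.ext_iff.1 heq
      exact absurd h₁ (hempty k l i h₂ c₂.2 hr)
    · obtain ⟨hr, hj⟩ := Prod.ext_iff.1 heq
      obtain rfl : j = l := hj
      rcases (rowParity_eq_iff i k).1 hr with rfl | rfl
      · rfl
      · by_cases hi : i < 2
        · exact absurd ⟨hi, h₂⟩ c₁
        · exact absurd ⟨hlt' i hi, (htwo i).symm ▸ h₁⟩ c₂
  calc S.ncard = (g '' S).ncard := hg.ncard_image.symm
    _ ≤ (Set.univ : Set (Fin 2 × W)).ncard := Set.ncard_le_ncard (Set.subset_univ _)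
    _ = 2 * Fintype.card W := by
      rw [Set.ncard_univ, Nat.card_eq_fintype_card, Fintype.card_prod, Fintype.card_fin]

/-- The upper total domination number of `C₄ □ H` is twice the order of `H`. -/
theorem upperTotalDominationNumber_C4_boxProd {W : Type*} [Fintype W] (H : SimpleGraph W) :
    upperTotalDominationNumber ((SimpleGraph.cycleGraph 4).boxProd H) =
      2 * Fintype.card W := by
  refine IsGreatest.csSup_eq ⟨⟨_, isMinimalTotalDominatingSet_two_rows H, ?_⟩, ?_⟩
  · have hrows : {v : Fin 4 × W | v.1 < 2} = Set.Iio 2 ×ˢ Set.univ := by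
      ext v
      simp
    have hIio : (Set.Iio (2 : Fin 4)).ncard = 2 := by
      rw [← Finset.coe_Iio, Set.ncard_coe_finset]
      rfl
    rw [hrows, Set.ncard_prod, hIio, Set.ncard_univ, Nat.card_eq_fintype_card]
  · rintro m ⟨S, hS, rfl⟩
    exact hS.ncard_le_of_boxProd

/-- For every `n ≥ 3`, the upper total domination number of `C₄ □ Cₙ`
equals `2n`. -/
theorem upperTotalDominationNumber_C4_boxProd_Cn (n : ℕ) (hn : 3 ≤ n) :
    upperTotalDominationNumber
      ((SimpleGraph.cycleGraph 4).boxProd (SimpleGraph.cycleGraph n)) = 2 * n := by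
  rw [upperTotalDominationNumber_C4_boxProd, Fintype.card_fin]
end
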